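/- The coefficient operator of the discrete pressure wave equation is symmetric and positive definite: let Δt > 0, γ > 1, and let h : (ZMod N) × (ZMod M) → ℝ be a vertex function with h(p) > 0 for every vertex p (the specific enthalpy weights h^{**,p}). Define the linear map M on cell functions by (M p)(c) = p(c)/(γ−1) − Δt²·(D_x(h·G_x p)(c) + D_y(h·G_y p)(c)), where h·G_k p denotes the pointwise product of the vertex functions h and G_k p. Then (i) M is self-adjoint for the ℓ² inner product: ∑_c (M p)(c)·q(c) = ∑_c p(c)·(M q)(c) for all cell functions p, q, and (ii) M is positive definite: ∑_c (M p)(c)·p(c) > 0 for every cell function p that is not identically zero. -/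

import Mathlib

variable {N M : ℕ}

/-- Cell-to-vertex gradient in the x-direction on the periodic staggered grid. -/
noncomputable def Gx (dx : ℝ) (φ : ZMod N × ZMod M → ℝ) : ZMod N × ZMod M → ℝ :=
  fun q => (φ (q.1, q.2) + φ (q.1, q.2 - 1) - φ (q.1 - 1, q.2) - φ (q.1 - 1, q.2 - 1)) / (2 * dx)

/-- Cell-to-vertex gradient in the y-direction on the periodic staggered grid. -/
noncomputable def Gy (dy : ℝ) (φ : ZMod N × ZMod M → ℝ) : ZMod N × ZMod M → ℝ :=
  fun q => (φ (q.1, q.2) + φ (q.1 - 1, q.2) - φ (q.1, q.2 - 1) - φ (q.1 - 1, q.2 - 1)) / (2 * dy)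

/-- Vertex-to-cell gradient in the x-direction on the periodic staggered grid. -/
noncomputable def Dx (dx : ℝ) (ψ : ZMod N × ZMod M → ℝ) : ZMod N × ZMod M → ℝ :=
  fun c => (ψ (c.1 + 1, c.2) + ψ (c.1 + 1, c.2 + 1) - ψ (c.1, c.2) - ψ (c.1, c.2 + 1)) / (2 * dx)

/-- Vertex-to-cell gradient in the y-direction on the periodic staggered grid. -/
noncomputable def Dy (dy : ℝ) (ψ : ZMod N × ZMod M → ℝ) : ZMod N × ZMod M → ℝ :=
  fun c => (ψ (c.1, c.2 + 1) + ψ (c.1 + 1, c.2 + 1) - ψ (c.1, c.2) - ψ (c.1 + 1, c.2)) / (2 * dy)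

/-- The coefficient operator of the discrete pressure wave equation,
(M p)(c) = p(c)/(γ−1) − Δt²·(D_x(h·G_x p)(c) + D_y(h·G_y p)(c)),
where h·ψ is the pointwise product of vertex functions. -/
noncomputable def Mop (dx dy Δt γ : ℝ) (h : ZMod N × ZMod M → ℝ)
    (p : ZMod N × ZMod M → ℝ) : ZMod N × ZMod M → ℝ :=
  fun c => p c / (γ - 1) -
    Δt ^ 2 * (Dx dx (fun q => h q * Gx dx p q) c + Dy dy (fun q => h q * Gy dy p q) c)

/-- Moving a periodic shift from one factor of a sum to the other. -/
theorem sum_shift_mul [NeZero N] [NeZero M] (ψ q : ZMod N × ZMod M → ℝ) (a : ZMod N)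
    (b : ZMod M) :
    ∑ c, ψ (c.1 + a, c.2 + b) * q c = ∑ c, ψ c * q (c.1 - a, c.2 - b) := by
  rw [← Equiv.sum_comp (Equiv.addRight (a, b)) fun c => ψ c * q (c.1 - a, c.2 - b)]
  refine Finset.sum_congr rfl fun c _ => ?_
  obtain ⟨i, j⟩ := c
  simp

/-- Summation by parts in the x-direction: `Dx` is minus the adjoint of `Gx`. -/
theorem sum_Dx_mul [NeZero N] [NeZero M] (dx : ℝ) (ψ q : ZMod N × ZMod M → ℝ) :
    ∑ c, Dx dx ψ c * q c = -∑ c, ψ c * Gx dx q c := by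
  have h10 := sum_shift_mul ψ q 1 0
  have h01 := sum_shift_mul ψ q 0 1
  have h11 := sum_shift_mul ψ q 1 1
  simp only [add_zero, sub_zero] at h10 h01
  simp only [Dx, Gx, div_mul_eq_mul_div, mul_div_assoc', ← Finset.sum_div, sub_mul, add_mul,
    mul_sub, mul_add, Finset.sum_sub_distrib, Finset.sum_add_distrib, h10, h01, h11, Prod.mk.eta]
  ring

/-- Summation by parts in the y-direction: `Dy` is minus the adjoint of `Gy`. -/
theorem sum_Dy_mul [NeZero N] [NeZero M] (dy : ℝ) (ψ q : ZMod N × ZMod M → ℝ) :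
    ∑ c, Dy dy ψ c * q c = -∑ c, ψ c * Gy dy q c := by
  have h10 := sum_shift_mul ψ q 1 0
  have h01 := sum_shift_mul ψ q 0 1
  have h11 := sum_shift_mul ψ q 1 1
  simp only [add_zero, sub_zero] at h10 h01
  simp only [Dy, Gy, div_mul_eq_mul_div, mul_div_assoc', ← Finset.sum_div, sub_mul, add_mul,
    mul_sub, mul_add, Finset.sum_sub_distrib, Finset.sum_add_distrib, h10, h01, h11, Prod.mk.eta]
  ring

/-- The bilinear form of `Mop` in weak form. -/
theorem sum_Mop_mul [NeZero N] [NeZero M] (dx dy Δt γ : ℝ) (h p q : ZMod N × ZMod M → ℝ) :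
    ∑ c, Mop dx dy Δt γ h p c * q c =
      ∑ c, (p c * q c / (γ - 1) +
        Δt ^ 2 * (h c * (Gx dx p c * Gx dx q c + Gy dy p c * Gy dy q c))) := by
  have hx := sum_Dx_mul dx (fun c => h c * Gx dx p c) q
  have hy := sum_Dy_mul dy (fun c => h c * Gy dy p c) q
  simp only [Mop, sub_mul, add_mul, mul_add, mul_assoc, div_mul_eq_mul_div,
    Finset.sum_sub_distrib, Finset.sum_add_distrib, ← Finset.mul_sum] at hx hy ⊢
  rw [hx, hy]
  ring

/-- The coefficient operator of the discrete pressure wave equation is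
self-adjoint for the ℓ² inner product and positive definite. -/
theorem pressure_operator_symmetric_posdef (N M : ℕ) [NeZero N] [NeZero M]
    (dx dy : ℝ) (hdx : 0 < dx) (hdy : 0 < dy) (Δt γ : ℝ) (hΔt : 0 < Δt) (hγ : 1 < γ)
    (h : ZMod N × ZMod M → ℝ) (hh : ∀ p, 0 < h p) :
    (∀ p q : ZMod N × ZMod M → ℝ,
      ∑ c : ZMod N × ZMod M, Mop dx dy Δt γ h p c * q c =
      ∑ c : ZMod N × ZMod M, p c * Mop dx dy Δt γ h q c) ∧
    (∀ p : ZMod N × ZMod M → ℝ, p ≠ 0 →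
      0 < ∑ c : ZMod N × ZMod M, Mop dx dy Δt γ h p c * p c) := by
  refine ⟨fun p q => ?_, fun p hp => ?_⟩
  · simp_rw [mul_comm (p _) (Mop _ _ _ _ _ _ _), sum_Mop_mul]
    exact Finset.sum_congr rfl fun c _ => by ring
  · rw [sum_Mop_mul]
    have hγ' : 0 < γ - 1 := sub_pos.2 hγ
    obtain ⟨c₀, hc₀⟩ := Function.ne_iff.1 hp
    have grad_nonneg (c) :
        0 ≤ Δt ^ 2 * (h c * (Gx dx p c * Gx dx p c + Gy dy p c * Gy dy p c)) :=
      mul_nonneg (sq_nonneg _) (mul_nonneg (hh c).le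
        (add_nonneg (mul_self_nonneg _) (mul_self_nonneg _)))
    exact Finset.sum_pos'
      (fun c _ => add_nonneg (div_nonneg (mul_self_nonneg _) hγ'.le) (grad_nonneg c))
      ⟨c₀, Finset.mem_univ _,
        add_pos_of_pos_of_nonneg (div_pos (mul_self_pos.2 hc₀) hγ') (grad_nonneg c₀)⟩
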